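/- In the combinatorial setup below, if in addition the sequence (λ_n) is summable, then the sequence (y_n) is F̄_K-Cauchy: for every ε > 0 there exists n_0 ∈ ℕ such that F̄_K(y_n, y_m) < ε for all m, n ≥ n_0. -/

import Mathlib

open MeasureTheory Filter Set
open scoped ENNReal NNReal

noncomputable section

/-- An `(n,δ)`-match between the sequences `x` and `y`, for the distance function `d`:
an order-preserving bijection `p` from `D` onto `R`, with `D, R ⊆ {0, …, n-1}`, such that
`d (x i) (y (p i)) < δ` for all `i ∈ D`.  The fit size of the match is `D.card`. -/
def IsMatch {X : Type*} (d : X → X → ℝ) (x y : ℕ → X) (n : ℕ) (δ : ℝ)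
    (D R : Finset ℕ) (p : ℕ → ℕ) : Prop :=
  (∀ i ∈ D, i < n) ∧ (∀ j ∈ R, j < n) ∧ Set.BijOn p ↑D ↑R ∧
  (∀ i ∈ D, ∀ j ∈ D, i < j → p i < p j) ∧ (∀ i ∈ D, d (x i) (y (p i)) < δ)

/-- The maximal fit size of an `(n,δ)`-match between `x` and `y`. -/
def maxFit {X : Type*} (d : X → X → ℝ) (x y : ℕ → X) (n : ℕ) (δ : ℝ) : ℕ :=
  sSup {m : ℕ | ∃ D R p, IsMatch d x y n δ D R p ∧ D.card = m}

/-- The `(n,δ)`-gap function `f̄_{n,δ}(x,y)`. -/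
def gapFn {X : Type*} (d : X → X → ℝ) (x y : ℕ → X) (n : ℕ) (δ : ℝ) : ℝ :=
  1 - (maxFit d x y n δ : ℝ) / n

/-- The `f̄_δ`-pseudo-distance: `f̄_δ(x,y) = limsup_n f̄_{n,δ}(x,y)`. -/
def gapDist {X : Type*} (d : X → X → ℝ) (x y : ℕ → X) (δ : ℝ) : ℝ :=
  Filter.limsup (fun n => gapFn d x y n δ) Filter.atTop

/-- The Feldman–Katok pseudometric `F̄_K(x,y) = inf {δ > 0 : f̄_δ(x,y) < δ}`. -/
def FKdist {X : Type*} (d : X → X → ℝ) (x y : ℕ → X) : ℝ :=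
  sInf {δ : ℝ | 0 < δ ∧ gapDist d x y δ < δ}


/-- The standard metric on the shift space `Σ_k = {1,…,k}^ℤ`:
`d(ξ,η) = 2^{-min{|j| : ξ_j ≠ η_j}}` (and `0` if `ξ = η`). -/
def shiftDist {k : ℕ} (ξ η : ℤ → Fin k) : ℝ :=
  haveI := Classical.propDecidable (ξ = η)
  if ξ = η then 0
  else (2 : ℝ) ^ (-((sInf {m : ℕ | ∃ j : ℤ, j.natAbs = m ∧ ξ j ≠ η j} : ℕ) : ℤ))

/-- The `σ`-periodic point of the shift generated by infinite repetition of the word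
`w 0, …, w (π - 1)` (so `w i` is the letter `ω_{i+1}` of the paper). -/
def perPoint {k : ℕ} (π : ℕ) (w : ℕ → Fin k) : ℤ → Fin k :=
  fun j => w (Int.toNat (j % (π : ℤ)))

/-- The `σ`-orbit sequence `(ξ, σξ, σ²ξ, …)` of a point `ξ` of the shift space. -/
def orbitSeq {k : ℕ} (ξ : ℤ → Fin k) : ℕ → (ℤ → Fin k) :=
  fun i j => ξ (j + i)

/-- `λ_n = R_n / (k_n π_{n-1})`. -/
def wordLam (π kseq Rseq : ℕ → ℕ) (n : ℕ) : ℝ :=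
  (Rseq n : ℝ) / ((kseq n : ℝ) * (π (n - 1) : ℝ))

lemma mem_upperBounds_fitSizes {X : Type*} (d : X → X → ℝ) (x y : ℕ → X) (n : ℕ) (δ : ℝ) :
    n ∈ upperBounds {m : ℕ | ∃ D R p, IsMatch d x y n δ D R p ∧ D.card = m} := by
  rintro m ⟨D, R, p, hM, rfl⟩
  simpa using Finset.card_le_card (fun i hi => Finset.mem_range.2 (hM.1 i hi) : D ⊆ Finset.range n)

lemma maxFit_le {X : Type*} (d : X → X → ℝ) (x y : ℕ → X) (n : ℕ) (δ : ℝ) :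
    maxFit d x y n δ ≤ n := by
  unfold maxFit
  rcases Set.eq_empty_or_nonempty
    {m : ℕ | ∃ D R p, IsMatch d x y n δ D R p ∧ D.card = m} with h | h
  · rw [h, csSup_empty]
    exact Nat.zero_le n
  · exact csSup_le h (mem_upperBounds_fitSizes d x y n δ)

lemma IsMatch.card_le_maxFit {X : Type*} {d : X → X → ℝ} {x y : ℕ → X} {n : ℕ} {δ : ℝ}
    {D R : Finset ℕ} {p : ℕ → ℕ} (h : IsMatch d x y n δ D R p) :
    D.card ≤ maxFit d x y n δ :=
  le_csSup ⟨n, mem_upperBounds_fitSizes d x y n δ⟩ ⟨D, R, p, h, rfl⟩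

lemma IsMatch.exists_swap {X : Type*} {d : X → X → ℝ} (hd : ∀ a b, d a b = d b a)
    {x y : ℕ → X} {n : ℕ} {δ : ℝ} {D R : Finset ℕ} {p : ℕ → ℕ} (h : IsMatch d x y n δ D R p) :
    ∃ q, IsMatch d y x n δ R D q := by
  obtain ⟨hD, hR, hp, hmono, hdist⟩ := h
  have hinv := hp.invOn_invFunOn
  have hq : Set.BijOn (Function.invFunOn p ↑D) (↑R : Set ℕ) ↑D :=
    (hp.symm hinv.symm)
  refine ⟨Function.invFunOn p ↑D, hR, hD, hq, fun i hi j hj hij => ?_, fun i hi => ?_⟩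
  · by_contra hcon
    have h1 : Function.invFunOn p ↑D i ∈ D := hq.mapsTo hi
    have h2 : Function.invFunOn p ↑D j ∈ D := hq.mapsTo hj
    have e1 := hinv.2 hi
    have e2 := hinv.2 hj
    rcases (not_lt.1 hcon).lt_or_eq with h' | h'
    · have := hmono _ h2 _ h1 h'
      omega
    · rw [h', e1] at e2
      omega
  · have h1 : Function.invFunOn p ↑D i ∈ D := hq.mapsTo hi
    have := hdist _ h1
    rwa [hinv.2 hi, hd] at this

lemma maxFit_comm {X : Type*} {d : X → X → ℝ} (hd : ∀ a b, d a b = d b a) (x y : ℕ → X)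
    (n : ℕ) (δ : ℝ) : maxFit d x y n δ = maxFit d y x n δ := by
  have key : ∀ x y : ℕ → X, {m : ℕ | ∃ D R p, IsMatch d x y n δ D R p ∧ D.card = m} ⊆
      {m : ℕ | ∃ D R p, IsMatch d y x n δ D R p ∧ D.card = m} := by
    rintro x y m ⟨D, R, p, h, rfl⟩
    obtain ⟨q, hq⟩ := h.exists_swap hd
    refine ⟨R, D, q, hq, ?_⟩
    have := h.2.2.1
    exact (Finset.card_nbij p this.mapsTo this.injOn this.surjOn).symm
  exact congrArg sSup ((key x y).antisymm (key y x))

lemma FKdist_comm {X : Type*} {d : X → X → ℝ} (hd : ∀ a b, d a b = d b a) (x y : ℕ → X) :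
    FKdist d x y = FKdist d y x := by
  simp only [FKdist, gapDist, gapFn, maxFit_comm hd x y]

lemma FKdist_le_of_eventually {X : Type*} {d : X → X → ℝ} {x y : ℕ → X} {δ b : ℝ} (hδ : 0 < δ)
    (hb : b < δ) (h : ∀ᶠ n in atTop, gapFn d x y n δ ≤ b) : FKdist d x y ≤ δ := by
  refine csInf_le ⟨0, fun _ h => h.1.le⟩ ⟨hδ, lt_of_le_of_lt ?_ hb⟩
  refine Filter.limsup_le_of_le (Filter.isCoboundedUnder_le_of_le atTop (x := 0) fun n => ?_) h
  have : (maxFit d x y n δ : ℝ) / n ≤ 1 :=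
    div_le_one_of_le₀ (by exact_mod_cast maxFit_le d x y n δ) (Nat.cast_nonneg n)
  simp only [gapFn]
  linarith

lemma shiftDist_comm {k : ℕ} (ξ η : ℤ → Fin k) : shiftDist ξ η = shiftDist η ξ := by
  by_cases h : ξ = η
  · rw [h]
  · simp only [shiftDist, if_neg h, if_neg (Ne.symm h), ne_comm (a := ξ _)]

/-- Two points that agree on the coordinates `|j| < L` are at distance at most `2^{-L}`. -/
lemma shiftDist_le_of_agree {k : ℕ} {ξ η : ℤ → Fin k} (L : ℕ)
    (h : ∀ j : ℤ, j.natAbs < L → ξ j = η j) : shiftDist ξ η ≤ (1 / 2 : ℝ) ^ L := by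
  unfold shiftDist
  split_ifs with he
  · positivity
  · have hne : {m : ℕ | ∃ j : ℤ, j.natAbs = m ∧ ξ j ≠ η j}.Nonempty := by
      obtain ⟨j, hj⟩ := Function.ne_iff.1 he
      exact ⟨_, j, rfl, hj⟩
    have hL : L ≤ sInf {m : ℕ | ∃ j : ℤ, j.natAbs = m ∧ ξ j ≠ η j} := by
      refine le_csInf hne ?_
      rintro m ⟨j, rfl, hj⟩
      by_contra hcon
      exact hj (h j (not_le.1 hcon))
    rw [zpow_neg, zpow_natCast, ← inv_pow, ← one_div]
    exact pow_le_pow_of_le_one (by norm_num) (by norm_num) hL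

lemma perPoint_natCast {k : ℕ} (π : ℕ) (w : ℕ → Fin k) (u : ℕ) :
    perPoint π w (u : ℤ) = w (u % π) := by
  simp only [perPoint]
  norm_cast

/-- An increasing embedding of `ℕ` into itself that carries the periodic sequence with generating
word `w` of length `P` into the one with generating word `w'` of length `P'`, is a translation on
each block of length `P`, and dilates by a factor at most `C`. -/
structure IsBlockEmbedding {k : ℕ} (P P' : ℕ) (w w' : ℕ → Fin k) (C : ℝ) (Φ : ℕ → ℕ) : Prop where
  strictMono : StrictMono Φ
  map_perPoint : ∀ u : ℕ, perPoint P' w' (Φ u : ℤ) = perPoint P w (u : ℤ)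
  translate : ∀ u v, u / P = v / P → Φ u + v = Φ v + u
  block : ∀ u v, u / P = v / P → Φ u / P' = Φ v / P'
  le_mul : ∀ u, (Φ u : ℝ) ≤ u * C

lemma IsBlockEmbedding.comp {k : ℕ} {P P' P'' : ℕ} {w w' w'' : ℕ → Fin k} {C C' : ℝ}
    {Φ Ψ : ℕ → ℕ} (hΨ : IsBlockEmbedding P' P'' w' w'' C' Ψ)
    (hΦ : IsBlockEmbedding P P' w w' C Φ) (hC' : 0 ≤ C') :
    IsBlockEmbedding P P'' w w'' (C * C') (Ψ ∘ Φ) where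
  strictMono := hΨ.strictMono.comp hΦ.strictMono
  map_perPoint u := (hΨ.map_perPoint (Φ u)).trans (hΦ.map_perPoint u)
  translate u v h := by
    have h1 := hΨ.translate _ _ (hΦ.block u v h)
    have h2 := hΦ.translate u v h
    simp only [Function.comp_apply]
    omega
  block u v h := hΨ.block _ _ (hΦ.block u v h)
  le_mul u := by
    calc (Ψ (Φ u) : ℝ) ≤ Φ u * C' := hΨ.le_mul _
      _ ≤ u * C * C' := mul_le_mul_of_nonneg_right (hΦ.le_mul u) hC'
      _ = u * (C * C') := mul_assoc _ _ _

lemma isBlockEmbedding_id {k : ℕ} (P : ℕ) (w : ℕ → Fin k) :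
    IsBlockEmbedding P P w w 1 id where
  strictMono := strictMono_id
  map_perPoint _ := rfl
  translate u v _ := add_comm u v
  block _ _ h := h
  le_mul u := by simp

/-- If `w'` is `a` copies of `w` followed by `r` further letters, insert `r` spacers after every
`a` copies of `w`. -/
lemma isBlockEmbedding_insert {k : ℕ} {P a r : ℕ} {w w' : ℕ → Fin k} (hP : 0 < P) (ha : 0 < a)
    (h : ∀ i < a * P, w' i = w (i % P)) :
    IsBlockEmbedding P (a * P + r) w w' (Real.exp (r / (a * P)))
      (fun u => u + u / (a * P) * r) := by
  have hQ : 0 < a * P := Nat.mul_pos ha hP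
  have hdm : ∀ u, u + u / (a * P) * r = u % (a * P) + (a * P + r) * (u / (a * P)) := fun u => by
    conv_lhs => rw [← Nat.mod_add_div u (a * P)]
    rw [Nat.add_mul_div_left _ _ hQ, Nat.div_eq_of_lt (Nat.mod_lt u hQ)]
    ring
  have hlt : ∀ u, u % (a * P) < a * P + r := fun u => (Nat.mod_lt u hQ).trans_le (by omega)
  have hblk : ∀ u v, u / P = v / P → u / (a * P) = v / (a * P) := fun u v huv => by
    rw [mul_comm a P, ← Nat.div_div_eq_div_mul, ← Nat.div_div_eq_div_mul, huv]
  refine ⟨fun u v huv => ?_, fun u => ?_, fun u v huv => ?_, fun u v huv => ?_, fun u => ?_⟩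
  · exact add_lt_add_of_lt_of_le huv (Nat.mul_le_mul_right r (Nat.div_le_div_right huv.le))
  · rw [perPoint_natCast, perPoint_natCast, hdm, Nat.add_mul_mod_self_left,
      Nat.mod_eq_of_lt (hlt u), h _ (Nat.mod_lt u hQ), Nat.mod_mod_of_dvd u (Dvd.intro_left a rfl)]
  · simp only [hblk u v huv]
    omega
  · have hd : ∀ u, (u + u / (a * P) * r) / (a * P + r) = u / (a * P) := fun u => by
      rw [hdm, Nat.add_mul_div_left _ _ (by omega), Nat.div_eq_of_lt (hlt u), zero_add]
    rw [hd, hd, hblk u v huv]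
  · have h1 : ((u / (a * P) : ℕ) : ℝ) ≤ u / (a * P : ℕ) := Nat.cast_div_le
    have h2 : (r : ℝ) / (a * P) + 1 ≤ Real.exp (r / (a * P)) := Real.add_one_le_exp _
    push_cast at h1 ⊢
    calc (u : ℝ) + (u / (a * P) : ℕ) * r ≤ u + u / (a * P) * r := by gcongr
      _ = u * (r / (a * P) + 1) := by ring
      _ ≤ _ := by gcongr

/-- The matched positions: in each of the first `T` blocks of length `P`, those at distance at
least `L` from the boundary of the block. -/
def blockInterior (T P L : ℕ) : Finset ℕ :=
  (Finset.range T ×ˢ Finset.Ico L (P - L)).image fun q => q.1 * P + q.2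

lemma card_blockInterior {T P L : ℕ} (hP : 0 < P) :
    (blockInterior T P L).card = T * (P - L - L) := by
  rw [blockInterior, Finset.card_image_of_injOn, Finset.card_product, Finset.card_range,
    Nat.card_Ico]
  rintro ⟨t, r⟩ h ⟨t', r'⟩ h' he
  simp only [Finset.coe_product, Set.mem_prod, Finset.mem_coe, Finset.mem_Ico] at h h'
  have hr : r < P := by omega
  have hr' : r' < P := by omega
  simp only at he
  have e1 := congrArg (· / P) he
  simp only [Nat.add_comm _ r, Nat.add_comm _ r', Nat.add_mul_div_right _ _ hP,
    Nat.div_eq_of_lt hr, Nat.div_eq_of_lt hr'] at e1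
  have : t = t' := by omega
  subst this
  simp only [Prod.mk.injEq, true_and]
  omega

lemma IsBlockEmbedding.shiftDist_orbitSeq_le {k : ℕ} {P P' : ℕ} {w w' : ℕ → Fin k} {C : ℝ}
    {Φ : ℕ → ℕ} (hΦ : IsBlockEmbedding P P' w w' C Φ) {t r L : ℕ} (h1 : L ≤ r) (h2 : r < P - L) :
    shiftDist (orbitSeq (perPoint P w) (t * P + r))
      (orbitSeq (perPoint P' w') (Φ (t * P + r))) ≤ (1 / 2 : ℝ) ^ L := by
  refine shiftDist_le_of_agree L fun j hj => ?_
  obtain ⟨r', hr'⟩ : ∃ r' : ℕ, (r' : ℤ) = j + r := ⟨(j + r).toNat, by omega⟩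
  have hP : 0 < P := by omega
  have hb : ∀ s < P, (t * P + s) / P = t := fun s hs => by
    rw [Nat.add_comm, Nat.add_mul_div_right _ _ hP, Nat.div_eq_of_lt hs, zero_add]
  have ht := hΦ.translate (t * P + r') (t * P + r) (by rw [hb _ (by omega), hb _ (by omega)])
  have e1 : j + ((t * P + r : ℕ) : ℤ) = ((t * P + r' : ℕ) : ℤ) := by push_cast; omega
  have e2 : j + ((Φ (t * P + r) : ℕ) : ℤ) = ((Φ (t * P + r') : ℕ) : ℤ) := by omega
  simp only [orbitSeq]
  rw [e1, e2, hΦ.map_perPoint]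

lemma IsBlockEmbedding.isMatch {k : ℕ} {P P' : ℕ} {w w' : ℕ → Fin k} {s : ℝ}
    {Φ : ℕ → ℕ} (hΦ : IsBlockEmbedding P P' w w' (Real.exp s) Φ) {δ : ℝ} {L : ℕ}
    (hL : (1 / 2 : ℝ) ^ L < δ) {T N : ℕ} (hT : ((T * P : ℕ) : ℝ) ≤ N * Real.exp (-s)) :
    IsMatch shiftDist (orbitSeq (perPoint P w)) (orbitSeq (perPoint P' w')) N δ
      (blockInterior T P L) ((blockInterior T P L).image Φ) Φ := by
  have hmem : ∀ u ∈ blockInterior T P L, ∃ t r, L ≤ r ∧ r < P - L ∧ t < T ∧ t * P + r = u := by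
    intro u hu
    simp only [blockInterior, Finset.mem_image, Finset.mem_product, Finset.mem_range,
      Finset.mem_Ico, Prod.exists] at hu
    obtain ⟨t, r, ⟨ht, hr⟩, rfl⟩ := hu
    exact ⟨t, r, hr.1, hr.2, ht, rfl⟩
  have hlt : ∀ u ∈ blockInterior T P L, Φ u < N := by
    intro u hu
    obtain ⟨t, r, h1, h2, ht, rfl⟩ := hmem u hu
    have hlt : t * P + r < T * P := by
      have := Nat.mul_le_mul_right P ht
      rw [Nat.succ_mul] at this
      omega
    have hlt' : ((t * P + r : ℕ) : ℝ) < N * Real.exp (-s) :=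
      lt_of_lt_of_le (by exact_mod_cast hlt) hT
    have : (Φ (t * P + r) : ℝ) < N := by
      calc (Φ (t * P + r) : ℝ) ≤ (t * P + r : ℕ) * Real.exp s := hΦ.le_mul _
        _ < N * Real.exp (-s) * Real.exp s := by gcongr
        _ = N := by rw [mul_assoc, ← Real.exp_add]; simp
    exact_mod_cast this
  refine ⟨fun i hi => (hΦ.strictMono.id_le i).trans_lt (hlt i hi), fun j hj => ?_, ?_,
    fun i _ j _ hij => hΦ.strictMono hij, fun i hi => ?_⟩
  · obtain ⟨i, hi, rfl⟩ := Finset.mem_image.1 hj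
    exact hlt i hi
  · rw [Finset.coe_image]
    exact hΦ.strictMono.injective.injOn.bijOn_image
  · obtain ⟨t, r, h1, h2, -, rfl⟩ := hmem i hi
    exact (hΦ.shiftDist_orbitSeq_le h1 h2).trans_lt hL

lemma IsBlockEmbedding.gapFn_le {k : ℕ} {P P' : ℕ} {w w' : ℕ → Fin k} {s : ℝ} (hs : 0 ≤ s)
    (hP : 0 < P) {Φ : ℕ → ℕ} (hΦ : IsBlockEmbedding P P' w w' (Real.exp s) Φ) {δ : ℝ} {L : ℕ}
    (hL : (1 / 2 : ℝ) ^ L < δ) {N : ℕ} (hN : 0 < N) :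
    gapFn shiftDist (orbitSeq (perPoint P w)) (orbitSeq (perPoint P' w')) N δ ≤
      s + 2 * L / P + P / N := by
  have hP' : (0 : ℝ) < P := by exact_mod_cast hP
  have hN' : (0 : ℝ) < N := by exact_mod_cast hN
  set x : ℝ := N * Real.exp (-s) with hx
  have hx0 : 0 ≤ x := by positivity
  have hxN : x ≤ N := mul_le_of_le_one_right hN'.le (Real.exp_le_one_iff.2 (by linarith))
  have hxl : N * (1 - s) ≤ x :=
    mul_le_mul_of_nonneg_left (by linarith [Real.add_one_le_exp (-s)]) hN'.le
  set T : ℕ := ⌊x / P⌋₊ with hTdef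
  have hT1 : (T : ℝ) ≤ x / P := Nat.floor_le (by positivity)
  have hT2 : x / P < T + 1 := Nat.lt_floor_add_one _
  have hT1' : (T : ℝ) * P ≤ x := (le_div_iff₀ hP').1 hT1
  have hT2' : x < (T + 1) * P := (div_lt_iff₀ hP').1 hT2
  have hm := (hΦ.isMatch hL (T := T) (N := N) (by push_cast; exact hT1')).card_le_maxFit
  rw [card_blockInterior hP] at hm
  have hsub : (P : ℝ) - 2 * L ≤ ((P - L - L : ℕ) : ℝ) := by
    have : P ≤ (P - L - L) + 2 * L := by omega
    have : (P : ℝ) ≤ (P - L - L : ℕ) + 2 * L := by exact_mod_cast this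
    linarith
  have hm' : (T : ℝ) * (P - 2 * L) ≤
      maxFit shiftDist (orbitSeq (perPoint P w)) (orbitSeq (perPoint P' w')) N δ := by
    refine (mul_le_mul_of_nonneg_left hsub (Nat.cast_nonneg T)).trans ?_
    exact_mod_cast hm
  have hTN : (T : ℝ) * (2 * L) ≤ N * (2 * L / P) := by
    calc (T : ℝ) * (2 * L) ≤ N / P * (2 * L) := by gcongr; exact hT1.trans (by gcongr)
      _ = N * (2 * L / P) := by ring
  have hfin : 1 - (s + 2 * L / P + P / N) ≤
      (maxFit shiftDist (orbitSeq (perPoint P w)) (orbitSeq (perPoint P' w')) N δ : ℝ) / N := by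
    rw [le_div_iff₀ hN']
    have : (P : ℝ) / N * N = P := by field_simp
    nlinarith
  simp only [gapFn]
  linarith

lemma IsBlockEmbedding.FKdist_le {k : ℕ} {P P' : ℕ} {w w' : ℕ → Fin k} {s : ℝ} (hs : 0 ≤ s)
    (hP : 0 < P) {Φ : ℕ → ℕ} (hΦ : IsBlockEmbedding P P' w w' (Real.exp s) Φ) {δ : ℝ} {L : ℕ}
    (hL : (1 / 2 : ℝ) ^ L < δ) (hδ : s + 2 * L / P < δ) :
    FKdist shiftDist (orbitSeq (perPoint P w)) (orbitSeq (perPoint P' w')) ≤ δ := by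
  obtain ⟨b, hb1, hb2⟩ := exists_between hδ
  refine FKdist_le_of_eventually (lt_of_le_of_lt (by positivity) hL) hb2 ?_
  have hlim : Tendsto (fun N : ℕ => (P : ℝ) / N) atTop (nhds 0) :=
    tendsto_const_div_atTop_nhds_zero_nat _
  filter_upwards [hlim.eventually_lt_const (sub_pos.2 hb1), eventually_gt_atTop 0] with N h1 h2
  linarith [hΦ.gapFn_le hs hP hL h2]

lemma wordLam_nonneg (π kseq Rseq : ℕ → ℕ) (n : ℕ) : 0 ≤ wordLam π kseq Rseq n := by
  unfold wordLam
  positivity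

lemma exists_isBlockEmbedding {k : ℕ} {π : ℕ → ℕ} {w : ℕ → ℕ → Fin k} {kseq Rseq : ℕ → ℕ}
    (hπ : ∀ n, 0 < π n) (hk : ∀ n, 1 ≤ n → 2 ≤ kseq n)
    (hrec : ∀ n, 1 ≤ n → π n = kseq n * π (n - 1) + Rseq n)
    (hword : ∀ n, 1 ≤ n → ∀ i < kseq n * π (n - 1), w n i = w (n - 1) (i % π (n - 1)))
    (n d : ℕ) : ∃ Φ, IsBlockEmbedding (π n) (π (n + d)) (w n) (w (n + d))
      (Real.exp (∑ i ∈ Finset.range d, wordLam π kseq Rseq (i + n + 1))) Φ := by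
  induction d with
  | zero => exact ⟨id, by simpa using isBlockEmbedding_id (π n) (w n)⟩
  | succ d ih =>
    obtain ⟨Φ, hΦ⟩ := ih
    have hstep := isBlockEmbedding_insert (r := Rseq (n + d + 1)) (hπ (n + d))
      (by have := hk (n + d + 1) (by omega); omega) (hword (n + d + 1) (by omega))
    have hπs := hrec (n + d + 1) (by omega)
    rw [Nat.add_sub_cancel] at hπs
    rw [← hπs] at hstep
    have hcomp := hstep.comp hΦ (Real.exp_pos _).le
    rw [Finset.sum_range_succ, Real.exp_add, Nat.add_comm d n]
    exact ⟨_, hcomp⟩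

/-- In the combinatorial setup, if the sequence `(λ_n)` is summable,
then the sequence of orbit sequences `y_n` is `F̄_K`-Cauchy. -/
theorem FK_cauchy_of_summable
    {k : ℕ} (π : ℕ → ℕ) (w : ℕ → ℕ → Fin k) (kseq Rseq : ℕ → ℕ)
    (hπ0 : 0 < π 0)
    (hk : ∀ n, 1 ≤ n → 2 ≤ kseq n)
    (hR : ∀ n, 1 ≤ n → 1 ≤ Rseq n)
    (hrec : ∀ n, 1 ≤ n → π n = kseq n * π (n - 1) + Rseq n)
    (hword : ∀ n, 1 ≤ n → ∀ i < kseq n * π (n - 1), w n i = w (n - 1) (i % π (n - 1)))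
    (hsum : Summable fun n => wordLam π kseq Rseq (n + 1)) :
    ∀ ε : ℝ, 0 < ε → ∃ n₀ : ℕ, ∀ m, n₀ ≤ m → ∀ n, n₀ ≤ n →
      FKdist shiftDist (orbitSeq (perPoint (π n) (w n)))
        (orbitSeq (perPoint (π m) (w m))) < ε := by
  have hgrow : ∀ n, n < π n := by
    intro n
    induction n with
    | zero => exact hπ0
    | succ n ih =>
      have h1 := hrec (n + 1) (by omega)
      have h2 := hR (n + 1) (by omega)
      have h3 := Nat.mul_le_mul_right (π n) (hk (n + 1) (by omega))
      rw [Nat.add_sub_cancel] at h1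
      omega
  have hπ : ∀ n, 0 < π n := fun n => (Nat.zero_le n).trans_lt (hgrow n)
  intro ε hε
  obtain ⟨L, hL⟩ := exists_pow_lt_of_lt_one (half_pos hε) (by norm_num : (1 / 2 : ℝ) < 1)
  have hlim : Tendsto (fun n : ℕ => (∑' i, wordLam π kseq Rseq (i + n + 1)) + 2 * (L : ℝ) / n)
      atTop (nhds (0 + 0)) :=
    (tendsto_sum_nat_add fun n => wordLam π kseq Rseq (n + 1)).add
      (tendsto_const_div_atTop_nhds_zero_nat _)
  rw [add_zero] at hlim
  obtain ⟨n₀, hn₀⟩ := eventually_atTop.1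
    ((hlim.eventually_lt_const (half_pos hε)).and (eventually_gt_atTop 0))
  have key : ∀ n, n₀ ≤ n → ∀ d, FKdist shiftDist (orbitSeq (perPoint (π n) (w n)))
      (orbitSeq (perPoint (π (n + d)) (w (n + d)))) < ε := by
    intro n hn d
    obtain ⟨Φ, hΦ⟩ := exists_isBlockEmbedding hπ hk hrec hword n d
    obtain ⟨hlt, hpos⟩ := hn₀ n hn
    have hpos' : (0 : ℝ) < n := by exact_mod_cast hpos
    have hle : ∑ i ∈ Finset.range d, wordLam π kseq Rseq (i + n + 1) ≤
        ∑' i, wordLam π kseq Rseq (i + n + 1) :=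
      ((summable_nat_add_iff n).2 hsum).sum_le_tsum _ fun i _ => wordLam_nonneg _ _ _ _
    have hdiv : 2 * (L : ℝ) / π n ≤ 2 * L / n := by
      gcongr
      exact (hgrow n).le
    have := hΦ.FKdist_le (Finset.sum_nonneg fun i _ => wordLam_nonneg _ _ _ _) (hπ n) hL
      (by linarith)
    linarith
  refine ⟨n₀, fun m hm n hn => ?_⟩
  rcases le_total n m with h | h
  · obtain ⟨d, rfl⟩ := Nat.exists_eq_add_of_le h
    exact key n hn d
  · obtain ⟨d, rfl⟩ := Nat.exists_eq_add_of_le h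
    rw [FKdist_comm shiftDist_comm]
    exact key m hm d

end
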